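/- With P = k[x,y,z,w], Φ a degree-3 Macaulay inverse system, and ann Φ containing no nonzero linear form, suppose x is a weak Lefschetz element of A = P/ann Φ, i.e. for every i ∈ ℕ the k-linear map A_i → A_{i+1} induced by multiplication by x has rank equal to min(dim_k A_i, dim_k A_{i+1}), where A_i := P_i/(ann Φ ∩ P_i). Then the k-linear map p : P_1 → Hom_k(P_1, k) defined by p(u)(v) = Φ(x·u·v) is bijective. -/

import Mathlib

open MvPolynomial

noncomputable section

variable (k : Type*) [Field k]

/-- The annihilator ideal `ann Φ = {f : Φ(f·g) = 0 for all g}` of the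
linear functional `Φ`. -/
def annIdeal (Φ : MvPolynomial (Fin 4) k →ₗ[k] k) : Ideal (MvPolynomial (Fin 4) k) where
  carrier := {f | ∀ g, Φ (f * g) = 0}
  add_mem' := by
    intro a b ha hb g
    rw [add_mul, map_add, ha g, hb g, add_zero]
  zero_mem' := by intro g; simp
  smul_mem' := by
    intro c a ha g
    have h : c • a * g = a * (c * g) := by rw [smul_eq_mul]; ring
    rw [h]; exact ha (c * g)

/-- `ann Φ ∩ P_i`, viewed as a `k`-subspace of the space `P_i` of homogeneous
polynomials of degree `i`. -/
def annInter (Φ : MvPolynomial (Fin 4) k →ₗ[k] k) (i : ℕ) :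
    Submodule k (homogeneousSubmodule (Fin 4) k i) :=
  Submodule.comap (homogeneousSubmodule (Fin 4) k i).subtype
    (Submodule.restrictScalars k (annIdeal k Φ))

/-- The degree-`i` graded piece `A_i = P_i/(ann Φ ∩ P_i)` of `P/ann Φ`. -/
abbrev gradedPiece (Φ : MvPolynomial (Fin 4) k →ₗ[k] k) (i : ℕ) :=
  homogeneousSubmodule (Fin 4) k i ⧸ annInter k Φ i

/-- Multiplication by `x` as a map `P_i → P_{i+1}`. -/
def mulXdeg (i : ℕ) :
    homogeneousSubmodule (Fin 4) k i →ₗ[k] homogeneousSubmodule (Fin 4) k (i + 1) where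
  toFun u := ⟨X 0 * u.1, by
    rw [mem_homogeneousSubmodule]
    have h2 : (u.1).IsHomogeneous i := (mem_homogeneousSubmodule _ _).1 u.2
    simpa [Nat.add_comm] using (isHomogeneous_X k (0 : Fin 4)).mul h2⟩
  map_add' u v := Subtype.ext (by simp [mul_add])
  map_smul' c u := Subtype.ext (by simp [mul_smul_comm])

/-- The Macaulay map `p : P₁ → Hom(P₁, k)`, `p(u)(v) = Φ(x·u·v)`. -/
def pMap (Φ : MvPolynomial (Fin 4) k →ₗ[k] k) :
    homogeneousSubmodule (Fin 4) k 1 →ₗ[k]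
      (homogeneousSubmodule (Fin 4) k 1 →ₗ[k] k) where
  toFun u :=
    { toFun := fun v => Φ (X 0 * u.1 * v.1)
      map_add' := fun v w => by simp [mul_add]
      map_smul' := fun c v => by simp [mul_smul_comm] }
  map_add' u u' := by
    ext v
    simp [add_mul, mul_add]
  map_smul' c u := by
    ext v
    simp [mul_smul_comm, smul_mul_assoc]

/-- The `k`-linear map `A_i → A_{i+1}` induced by multiplication by `x`. -/
def lefschetzMap (Φ : MvPolynomial (Fin 4) k →ₗ[k] k) (i : ℕ) :
    gradedPiece k Φ i →ₗ[k] gradedPiece k Φ (i + 1) :=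
  Submodule.mapQ (annInter k Φ i) (annInter k Φ (i + 1)) (mulXdeg k i)
    (by
      intro u hu
      have h : ∀ g, Φ (u.1 * g) = 0 := hu
      intro g
      show Φ (X 0 * u.1 * g) = 0
      have : X 0 * u.1 * g = u.1 * (X 0 * g) := by ring
      rw [this]; exact h (X 0 * g))

theorem aux_zero {k : Type*} [Field k] (Φ : MvPolynomial (Fin 4) k →ₗ[k] k)
    (hΦ : ∀ m : Fin 4 →₀ ℕ, (m.sum fun _ e => e) ≠ 3 → Φ (monomial m 1) = 0)
    (h : MvPolynomial (Fin 4) k) (n : ℕ) (hn : n ≠ 3) (hh : h.IsHomogeneous n) : Φ h = 0 := by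
  rw [h.as_sum, map_sum]
  refine Finset.sum_eq_zero fun m hm => ?_
  have hd : m.degree = n := by
    have := hh (mem_support_iff.1 hm)
    rw [Finsupp.degree_eq_weight_one]
    exact this
  have h1 : (monomial m (coeff m h) : MvPolynomial (Fin 4) k)
      = coeff m h • monomial m 1 := by simp [smul_monomial]
  rw [h1, map_smul, hΦ m, smul_zero]
  intro h3
  apply hn
  rw [← hd, ← h3]
  rfl

theorem aux_ann {k : Type*} [Field k] (Φ : MvPolynomial (Fin 4) k →ₗ[k] k)
    (hΦ : ∀ m : Fin 4 →₀ ℕ, (m.sum fun _ e => e) ≠ 3 → Φ (monomial m 1) = 0)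
    (f : MvPolynomial (Fin 4) k) (i j : ℕ) (hij : i + j = 3) (hf : f.IsHomogeneous i)
    (H : ∀ g : MvPolynomial (Fin 4) k, g.IsHomogeneous j → Φ (f * g) = 0) :
    f ∈ annIdeal k Φ := by
  intro g
  rw [g.as_sum, Finset.mul_sum, map_sum]
  refine Finset.sum_eq_zero fun m _ => ?_
  have hm : (monomial m (coeff m g) : MvPolynomial (Fin 4) k).IsHomogeneous m.degree :=
    isHomogeneous_monomial _ rfl
  by_cases hd : m.degree = j
  · exact H _ (hd ▸ hm)
  · exact aux_zero Φ hΦ _ _ (by omega) (hf.mul hm)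

theorem aux_fin (k : Type*) [Field k] (n : ℕ) :
    Module.Finite k (homogeneousSubmodule (Fin 4) k n) := by
  exact Module.Finite.iff_fg.2 (homogeneousSubmodule_fg (Fin 4) k n)

/-- pairing -/
def auxPair {k : Type*} [Field k] (Φ : MvPolynomial (Fin 4) k →ₗ[k] k) :
    homogeneousSubmodule (Fin 4) k 1 →ₗ[k] Module.Dual k (gradedPiece k Φ 2) where
  toFun u := Submodule.liftQ (annInter k Φ 2)
    ((Φ ∘ₗ LinearMap.mulLeft k u.1) ∘ₗ (homogeneousSubmodule (Fin 4) k 2).subtype) (by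
      intro q hq
      have h : ∀ g, Φ (q.1 * g) = 0 := hq
      simpa [mul_comm] using h u.1)
  map_add' u v := by
    ext q
    simp [add_mul]
  map_smul' c u := by
    ext q
    simp

/-- **Observation 2.11** (together with \cite[Prop.~1.8]{EKK1}).  If `Φ` is a
degree-3 Macaulay inverse system with `ann Φ` containing no nonzero linear
form, and `x` is a weak Lefschetz element of `A = P/ann Φ` (every
multiplication map `A_i → A_{i+1}` has maximal rank), then the map
`p : P₁ → Hom_k(P₁,k)`, `p(u)(v) = Φ(x·u·v)`, is bijective. -/
theorem pMap_bijective_of_weakLefschetz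
    (Φ : MvPolynomial (Fin 4) k →ₗ[k] k)
    (hΦ : ∀ m : Fin 4 →₀ ℕ, (m.sum fun _ e => e) ≠ 3 → Φ (monomial m 1) = 0)
    (hlin : ∀ u ∈ homogeneousSubmodule (Fin 4) k 1, u ∈ annIdeal k Φ → u = 0)
    (hWL : ∀ i : ℕ, LinearMap.rank (lefschetzMap k Φ i) =
      min (Module.rank k (gradedPiece k Φ i)) (Module.rank k (gradedPiece k Φ (i + 1)))) :
    Function.Bijective (pMap k Φ) := by
  have := aux_fin k 1
  have := aux_fin k 2
  have hinj2 : Function.Injective (auxPair Φ) := by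
    rw [injective_iff_map_eq_zero]
    intro u hu
    refine Subtype.ext (hlin u.1 u.2 (aux_ann Φ hΦ u.1 1 2 rfl u.2 fun g hg => ?_))
    exact LinearMap.congr_fun hu (Submodule.Quotient.mk ⟨g, hg⟩)
  have hle : Module.finrank k (gradedPiece k Φ 1) ≤ Module.finrank k (gradedPiece k Φ 2) :=
    (Submodule.finrank_quotient_le _).trans
      ((LinearMap.finrank_le_finrank_of_injective hinj2).trans
        (Subspace.dual_finrank_eq).le)
  have hr := hWL 1
  have hle' : Module.rank k (gradedPiece k Φ 1) ≤ Module.rank k (gradedPiece k Φ (1 + 1)) := by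
    rw [← Module.finrank_eq_rank, ← Module.finrank_eq_rank]
    exact_mod_cast hle
  rw [min_eq_left hle'] at hr
  have hL : Function.Injective (lefschetzMap k Φ 1) := by
    rw [← LinearMap.ker_eq_bot]
    have h1 := LinearMap.finrank_range_add_finrank_ker (lefschetzMap k Φ 1)
    have h2 : Module.finrank k (LinearMap.range (lefschetzMap k Φ 1))
        = Module.finrank k (gradedPiece k Φ 1) := congrArg Cardinal.toNat hr
    exact Submodule.finrank_eq_zero.1 (by omega)
  have hp : Function.Injective (pMap k Φ) := by
    rw [injective_iff_map_eq_zero]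
    intro u hu
    have hxu : X 0 * u.1 ∈ annIdeal k Φ :=
      aux_ann Φ hΦ _ 2 1 rfl (mulXdeg k 1 u).2 fun g hg =>
        LinearMap.congr_fun hu (⟨g, hg⟩ : homogeneousSubmodule (Fin 4) k 1)
    have h0 : lefschetzMap k Φ 1 (Submodule.Quotient.mk u) = 0 :=
      (Submodule.Quotient.mk_eq_zero (annInter k Φ 2) (x := mulXdeg k 1 u)).2 hxu
    have h1 := hL (h0.trans (map_zero _).symm)
    have h2 : u ∈ annInter k Φ 1 := (Submodule.Quotient.mk_eq_zero _).1 h1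
    exact Subtype.ext (hlin u.1 u.2 h2)
  exact ⟨hp, (LinearMap.injective_iff_surjective_of_finrank_eq_finrank
    (Subspace.dual_finrank_eq (K := k)).symm).1 hp⟩

end
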